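/- arXiv:2605.17970 — 2 statements merged into one kernel-verified Lean document; each statement's English description precedes it below -/
import Mathlib

section
/- Let 1 < p < ∞ with p ≠ 2, and let g : ℝ → ℂ be a continuous function belonging to the Wiener amalgam space W(L^∞, ℓ¹), i.e. Σ_{k∈ℤ} sup_{x∈[k,k+1]} |g(x)| < ∞. Let T ⊂ ℝ be a uniformly discrete set and let Λ ⊂ T × ℝ be a countable set. Then for every family (g*_{ts})_{(t,s)∈Λ} of continuous linear functionals on L^p(ℝ;ℂ), the family of pairs ((e_s τ_t g, g*_{ts}))_{(t,s)∈Λ} does not form an unconditional Schauder frame for L^p(ℝ;ℂ). -/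
open MeasureTheory Filter
open scoped ENNReal

noncomputable section

/-- The time–frequency shift `(e_s τ_t g)(x) = g(x-t) e^{2πisx}`. -/
def gabor (g : ℝ → ℂ) (t s : ℝ) : ℝ → ℂ := fun x =>
  g (x - t) * Complex.exp (2 * (Real.pi : ℂ) * Complex.I * ((s : ℂ) * (x : ℂ)))

/-- Unconditional summability of the family `F` in `L^p(μ)`, with sum `f`:
the net of finite partial sums converges to `f` in the `L^p` (semi)norm. -/
def UncondSum {ι : Type*} (p : ℝ≥0∞) (μ : Measure ℝ) (F : ι → ℝ → ℂ) (f : ℝ → ℂ) : Prop :=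
  Filter.Tendsto
    (fun A : Finset ι => eLpNorm (fun x => (∑ j ∈ A, F j x) - f x) p μ)
    Filter.atTop (nhds 0)

/-- Bounded multipliers act uniformly boundedly on a summable family. -/
theorem exists_bound_norm_sum_smul_of_summable {ι E : Type*} [NormedAddCommGroup E]
    [NormedSpace ℂ E] [CompleteSpace E] {x : ι → E} (hx : Summable x) :
    ∃ C : ℝ, ∀ (A : Finset ι) (m : ι → ℂ), (∀ j, ‖m j‖ ≤ 1) → ‖∑ j ∈ A, m j • x j‖ ≤ C := by
  classical
  obtain ⟨s, hs⟩ := summable_iff_vanishing_norm.1 hx 1 one_pos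
  set D : ℝ := 1 + ∑ j ∈ s, ‖x j‖ with hD
  have hB : ∀ B : Finset ι, ‖∑ j ∈ B, x j‖ ≤ D := by
    intro B
    rw [← Finset.sum_sdiff (Finset.inter_subset_left : B ∩ s ⊆ B)]
    refine (norm_add_le _ _).trans (add_le_add ?_ ?_)
    · refine (hs _ ?_).le
      rw [Finset.disjoint_left]
      intro a ha has
      simp only [Finset.mem_sdiff, Finset.mem_inter] at ha
      exact ha.2 ⟨ha.1, has⟩
    · exact (norm_sum_le _ _).trans
        (Finset.sum_le_sum_of_subset_of_nonneg Finset.inter_subset_right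
          fun _ _ _ => norm_nonneg _)
  have habs : ∀ (A : Finset ι) (r : ι → ℝ),
      (∀ B ⊆ A, |∑ j ∈ B, r j| ≤ D) → ∑ j ∈ A, |r j| ≤ 2 * D := by
    intro A r h
    rw [← Finset.sum_filter_add_sum_filter_not A (fun j => 0 ≤ r j)]
    have h1 := (abs_le.1 (h _ (Finset.filter_subset (fun j => 0 ≤ r j) A))).2
    have h2 := (abs_le.1 (h _ (Finset.filter_subset (fun j => ¬ 0 ≤ r j) A))).1
    have e1 : ∑ j ∈ A.filter (fun j => 0 ≤ r j), |r j| = ∑ j ∈ A.filter (fun j => 0 ≤ r j), r j :=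
      Finset.sum_congr rfl fun j hj => abs_of_nonneg (Finset.mem_filter.1 hj).2
    have e2 : ∑ j ∈ A.filter (fun j => ¬ 0 ≤ r j), |r j|
        = -∑ j ∈ A.filter (fun j => ¬ 0 ≤ r j), r j := by
      rw [← Finset.sum_neg_distrib]
      exact Finset.sum_congr rfl fun j hj => abs_of_neg (not_le.1 (Finset.mem_filter.1 hj).2)
    linarith
  refine ⟨4 * D, fun A m hm => ?_⟩
  obtain ⟨φ, hφ, hφx⟩ := exists_dual_vector'' ℂ (∑ j ∈ A, m j • x j)
  have hφB : ∀ B : Finset ι, ‖∑ j ∈ B, φ (x j)‖ ≤ D := by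
    intro B
    rw [← map_sum]
    refine (φ.le_opNorm _).trans ?_
    have := hB B
    nlinarith [norm_nonneg (∑ j ∈ B, x j)]
  have hre : ∑ j ∈ A, |(φ (x j)).re| ≤ 2 * D := habs A _ fun B _ => by
    rw [← Complex.re_sum]
    exact (Complex.abs_re_le_norm _).trans (hφB B)
  have him : ∑ j ∈ A, |(φ (x j)).im| ≤ 2 * D := habs A _ fun B _ => by
    rw [← Complex.im_sum]
    exact (Complex.abs_im_le_norm _).trans (hφB B)
  have key : ‖∑ j ∈ A, m j • x j‖ = ‖φ (∑ j ∈ A, m j • x j)‖ := by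
    rw [hφx]; simp
  rw [key, map_sum]
  calc ‖∑ j ∈ A, φ (m j • x j)‖ ≤ ∑ j ∈ A, (|(φ (x j)).re| + |(φ (x j)).im|) := by
        refine norm_sum_le_of_le _ fun j _ => ?_
        rw [map_smul, norm_smul]
        refine (mul_le_of_le_one_left (norm_nonneg _) (hm j)).trans ?_
        exact Complex.norm_le_abs_re_add_abs_im _
    _ ≤ 4 * D := by rw [Finset.sum_add_distrib]; linarith

/-- Uniform bound for the multiplier operators of an unconditionally converging expansion. -/
theorem exists_multiplier_bound {ι E F : Type*} [NormedAddCommGroup E]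
    [NormedSpace ℂ E] [CompleteSpace E] [NormedAddCommGroup F]
    [NormedSpace ℂ F] [CompleteSpace F] (c : ι → E →L[ℂ] ℂ) (u : ι → F)
    (h : ∀ f, Summable fun j => c j f • u j) :
    ∃ K : ℝ, 0 ≤ K ∧ ∀ (A : Finset ι) (m : ι → ℂ) (B : ℝ), 0 < B → (∀ j, ‖m j‖ ≤ B) →
      ∀ f, ‖∑ j ∈ A, m j • (c j f • u j)‖ ≤ B * (K * ‖f‖) := by
  let T : (Finset ι × {m : ι → ℂ // ∀ j, ‖m j‖ ≤ 1}) → E →L[ℂ] F := fun i =>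
    ∑ j ∈ i.1, i.2.1 j • (c j).smulRight (u j)
  have hT : ∀ i f, T i f = ∑ j ∈ i.1, i.2.1 j • (c j f • u j) := by
    intro i f
    simp [T]
  obtain ⟨K, hK⟩ := banach_steinhaus (g := T) fun f => by
    obtain ⟨C, hC⟩ := exists_bound_norm_sum_smul_of_summable (h f)
    exact ⟨C, fun i => by rw [hT]; exact hC _ _ i.2.2⟩
  have hK0 : 0 ≤ K := (norm_nonneg _).trans (hK (∅, ⟨fun _ => 0, by simp⟩))
  refine ⟨K, hK0, fun A m B hB hm f => ?_⟩
  have h1 : ∀ j, ‖(B : ℂ)⁻¹ * m j‖ ≤ 1 := fun j => by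
    rw [norm_mul, norm_inv, Complex.norm_real, Real.norm_of_nonneg hB.le]
    rw [inv_mul_le_iff₀ hB]; simpa using hm j
  have h2 := ((T (A, ⟨_, h1⟩)).le_of_opNorm_le (hK _) f)
  rw [hT] at h2
  have h3 : ∑ j ∈ A, m j • (c j f • u j)
      = (B : ℂ) • ∑ j ∈ A, ((B : ℂ)⁻¹ * m j) • (c j f • u j) := by
    rw [Finset.smul_sum]
    refine Finset.sum_congr rfl fun j _ => ?_
    rw [smul_smul (B : ℂ), ← mul_assoc, mul_inv_cancel₀ (by exact_mod_cast hB.ne'), one_mul]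
  rw [h3, norm_smul, Complex.norm_real, Real.norm_of_nonneg hB.le]
  exact mul_le_mul_of_nonneg_left h2 hB.le

/-- Rudin–Shapiro polynomials. -/
theorem exists_rudinShapiro (m : ℕ) : ∃ a b : ℕ → ℂ, (∀ k, a k = 1 ∨ a k = -1) ∧
    (∀ k, b k = 1 ∨ b k = -1) ∧ ∀ z : ℂ, ‖z‖ = 1 →
      ‖∑ k ∈ Finset.range (2 ^ m), a k * z ^ k‖ ^ 2 +
        ‖∑ k ∈ Finset.range (2 ^ m), b k * z ^ k‖ ^ 2 = 2 * 2 ^ m := by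
  induction m with
  | zero => exact ⟨fun _ => 1, fun _ => 1, by simp, by simp, by intro z _; norm_num⟩
  | succ m ih =>
    obtain ⟨a, b, ha, hb, h⟩ := ih
    refine ⟨fun k => if k < 2 ^ m then a k else b (k - 2 ^ m),
      fun k => if k < 2 ^ m then a k else -b (k - 2 ^ m), ?_, ?_, ?_⟩
    · intro k; dsimp only; split_ifs
      · exact ha k
      · exact hb _
    · intro k; dsimp only; split_ifs
      · exact ha k
      · rcases hb (k - 2 ^ m) with h | h <;> simp [h]
    · intro z hz
      have e : ∀ c : ℕ → ℂ, ∑ k ∈ Finset.range (2 ^ (m + 1)),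
          (if k < 2 ^ m then a k else c (k - 2 ^ m)) * z ^ k =
          ∑ k ∈ Finset.range (2 ^ m), a k * z ^ k
            + z ^ (2 ^ m) * ∑ k ∈ Finset.range (2 ^ m), c k * z ^ k := by
        intro c
        rw [pow_succ, mul_two, Finset.sum_range_add, Finset.mul_sum]
        congr 1
        · exact Finset.sum_congr rfl fun k hk => by rw [if_pos (Finset.mem_range.1 hk)]
        · refine Finset.sum_congr rfl fun k _ => ?_
          rw [if_neg (by omega), Nat.add_sub_cancel_left, pow_add]; ring
      rw [e b, e fun k => -b k]
      simp only [neg_mul, Finset.sum_neg_distrib, mul_neg, ← sub_eq_add_neg]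
      rw [parallelogram_law_with_norm ℂ, norm_mul, norm_pow, hz, one_pow, one_mul, h z hz]
      ring

/-- The suprema over unit intervals dominate a continuous function. -/
theorem norm_le_iSup_Icc_floor {g : ℝ → ℂ} (hgc : Continuous g) (y : ℝ) :
    ‖g y‖ ≤ ⨆ x : Set.Icc ((⌊y⌋ : ℤ) : ℝ) ((⌊y⌋ : ℝ) + 1), ‖g (x : ℝ)‖ := by
  refine le_ciSup (f := fun x : Set.Icc ((⌊y⌋ : ℤ) : ℝ) ((⌊y⌋ : ℝ) + 1) => ‖g (x : ℝ)‖) ?_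
    ⟨y, Int.floor_le y, (Int.lt_floor_add_one y).le⟩
  exact (isCompact_range (by fun_prop)).bddAbove

/-- Sums over a uniformly discrete set are controlled by sums over the integers. -/
theorem summable_floor_of_uniformlyDiscrete {T : Set ℝ} {ρ : ℝ} (hρ : 0 < ρ)
    (hT : ∀ t ∈ T, ∀ t' ∈ T, t ≠ t' → ρ ≤ |t - t'|) {b : ℤ → ℝ} (hb0 : ∀ k, 0 ≤ b k)
    (hb : Summable b) : Summable fun t : T => b ⌊(t : ℝ)⌋ := by
  obtain ⟨n, hn⟩ := exists_nat_one_div_lt hρ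
  set N : ℕ := n + 1 with hN
  have hN0 : (0 : ℝ) < N := by positivity
  have hprod : Summable fun x : ℤ × Fin N => b x.1 := by
    refine (summable_prod_of_nonneg fun x => hb0 x.1).2 ⟨fun k => (hasSum_fintype _).summable, ?_⟩
    simpa using hb.mul_left (N : ℝ)
  have hdiv : Summable fun q : ℤ => b (q / N) :=
    hprod.comp_injective (Int.divModEquiv N).injective
  have hinj : Function.Injective fun t : T => ⌊(t : ℝ) * N⌋ := by
    intro t t' h
    by_contra hne
    have h1 := hT t t.2 t' t'.2 fun h => hne (Subtype.ext h)
    have h2 := Int.abs_sub_lt_one_of_floor_eq_floor h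
    rw [← sub_mul, abs_mul, abs_of_pos hN0, ← lt_div_iff₀ hN0] at h2
    have h3 : (1 : ℝ) / N < ρ := by simpa [hN] using hn
    linarith
  refine (hdiv.comp_injective hinj).congr fun t => ?_
  simp only [Function.comp_apply]
  rw [← Int.floor_div_natCast, mul_div_cancel_right₀ _ hN0.ne']

/-- Small translations of a function in the amalgam space `W(L^∞, ℓ¹)` are small, summed along a
uniformly discrete set. -/
theorem exists_summable_modulus {g : ℝ → ℂ} (hgc : Continuous g)
    (hgW : Summable fun k : ℤ => ⨆ x : Set.Icc (k : ℝ) ((k : ℝ) + 1), ‖g (x : ℝ)‖)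
    {T : Set ℝ} (hT : ∃ ρ > (0:ℝ), ∀ t ∈ T, ∀ t' ∈ T, t ≠ t' → ρ ≤ |t - t'|)
    {ε : ℝ} (hε : 0 < ε) :
    ∃ h₀ > (0 : ℝ), ∃ w : ℝ → ℝ, (∀ t, 0 ≤ w t) ∧
      (∀ t ∈ T, ∀ h, |h| ≤ h₀ → ∀ x ∈ Set.Icc (0 : ℝ) 1, ‖g (x - h - t) - g (x - t)‖ ≤ w t) ∧
      ∀ S : Finset ℝ, ↑S ⊆ T → ∑ t ∈ S, w t ≤ ε := by
  classical
  obtain ⟨ρ, hρ, hT⟩ := hT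
  set a : ℤ → ℝ := fun k => ⨆ x : Set.Icc (k : ℝ) ((k : ℝ) + 1), ‖g (x : ℝ)‖ with ha
  have ha0 : ∀ k, 0 ≤ a k := fun k => Real.iSup_nonneg fun _ => norm_nonneg _
  have hga : ∀ y, ‖g y‖ ≤ a ⌊y⌋ := norm_le_iSup_Icc_floor hgc
  set b : ℤ → ℝ := fun k => 2 * ∑ i ∈ Finset.Icc (-2 : ℤ) 2, a (-k + i) with hb
  have hb0 : ∀ k, 0 ≤ b k := fun k => mul_nonneg two_pos.le (Finset.sum_nonneg fun i _ => ha0 _)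
  have hbs : Summable b := by
    refine Summable.mul_left _ (summable_sum fun i _ => ?_)
    exact hgW.comp_injective (i := fun k : ℤ => -k + i) fun k k' h => by simpa using h
  have hbg : ∀ t y : ℝ, y ≤ 2 → -1 ≤ y → 2 * ‖g (y - t)‖ ≤ b ⌊t⌋ := by
    intro t y hy1 hy2
    refine mul_le_mul_of_nonneg_left ((hga _).trans ?_) two_pos.le
    have e : ⌊y - t⌋ = -⌊t⌋ + (⌊y - t⌋ + ⌊t⌋) := by ring
    rw [e]
    refine Finset.single_le_sum (f := fun i => a (-⌊t⌋ + i)) (fun i _ => ha0 _) ?_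
    have h1 := Int.floor_le (y - t)
    have h2 := Int.lt_floor_add_one (y - t)
    have h3 := Int.floor_le t
    have h4 := Int.lt_floor_add_one t
    rw [Finset.mem_Icc]
    constructor
    · have : (-3 : ℝ) < ((⌊y - t⌋ + ⌊t⌋ : ℤ) : ℝ) := by push_cast; linarith
      have : (-3 : ℤ) < ⌊y - t⌋ + ⌊t⌋ := by exact_mod_cast this
      omega
    · have : ((⌊y - t⌋ + ⌊t⌋ : ℤ) : ℝ) ≤ 2 := by push_cast; linarith
      exact_mod_cast this
  have hsum := summable_floor_of_uniformlyDiscrete hρ hT hb0 hbs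
  obtain ⟨S₀, hS₀⟩ := summable_iff_vanishing_norm.1 hsum (ε / 2) (half_pos hε)
  set η : ℝ := ε / (2 * (S₀.card + 1)) with hη
  have hη0 : 0 < η := by positivity
  have hmod : ∀ t : ℝ, ∃ h₀ > (0 : ℝ), ∀ h, |h| ≤ h₀ → ∀ x ∈ Set.Icc (0 : ℝ) 1,
      ‖g (x - h - t) - g (x - t)‖ ≤ η := by
    intro t
    have hu := (isCompact_Icc (a := -2 - t) (b := 2 - t)).uniformContinuousOn_of_continuous
      hgc.continuousOn
    obtain ⟨δ, hδ, hu⟩ := Metric.uniformContinuousOn_iff.1 hu η hη0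
    refine ⟨min 1 (δ / 2), by positivity, fun h hh x hx => ?_⟩
    have hh1 := abs_le.1 (hh.trans (min_le_left _ _))
    rw [← dist_eq_norm]
    refine (hu _ ⟨by linarith [hx.1], by linarith [hx.2]⟩ _
      ⟨by linarith [hx.1], by linarith [hx.2]⟩ ?_).le
    rw [Real.dist_eq, show x - h - t - (x - t) = -h by ring, abs_neg]
    linarith [hh.trans (min_le_right _ _)]
  choose H hH0 hH using hmod
  obtain ⟨h₀, hh₀, hh₀H⟩ : ∃ h₀ > (0 : ℝ), ∀ t ∈ S₀, h₀ ≤ H (t : ℝ) := by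
    rcases S₀.eq_empty_or_nonempty with rfl | hne
    · exact ⟨1, one_pos, by simp⟩
    · obtain ⟨t, _, ht⟩ := S₀.exists_min_image (fun t => H (t : ℝ)) hne
      exact ⟨H t, hH0 _, ht⟩
  set T₀ : Finset ℝ := S₀.image (fun t : T => (t : ℝ)) with hT₀
  refine ⟨min 1 h₀, by positivity, fun t => if t ∈ T₀ then η else b ⌊t⌋, ?_, ?_, ?_⟩
  · intro t
    dsimp only
    split_ifs
    exacts [hη0.le, hb0 _]
  · intro t _ h hh x hx
    dsimp only
    split_ifs with htS
    · obtain ⟨t', ht', rfl⟩ := Finset.mem_image.1 htS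
      exact hH _ h ((hh.trans (min_le_right _ _)).trans (hh₀H _ ht')) x hx
    · have hh1 := abs_le.1 (hh.trans (min_le_left _ _))
      have h1 := hbg t (x - h) (by linarith [hx.2]) (by linarith [hx.1])
      have h2 := hbg t x (by linarith [hx.2]) (by linarith [hx.1])
      linarith [norm_sub_le (g (x - h - t)) (g (x - t))]
  · intro S hS
    rw [← Finset.sum_filter_add_sum_filter_not S (fun t => t ∈ T₀)]
    have h1 : ∑ t ∈ S.filter (fun t => t ∈ T₀), (if t ∈ T₀ then η else b ⌊t⌋) ≤ ε / 2 := by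
      calc _ ≤ ∑ t ∈ S.filter (fun t => t ∈ T₀), η :=
            Finset.sum_le_sum fun t ht => by rw [if_pos (Finset.mem_filter.1 ht).2]
        _ ≤ (S₀.card + 1) * η := by
            rw [Finset.sum_const, nsmul_eq_mul]
            refine mul_le_mul_of_nonneg_right ?_ hη0.le
            have h1 : (S.filter (fun t => t ∈ T₀)).card ≤ S₀.card :=
              (Finset.card_le_card fun t ht => (Finset.mem_filter.1 ht).2).trans
                Finset.card_image_le
            have : ((S.filter (fun t => t ∈ T₀)).card : ℝ) ≤ S₀.card := by exact_mod_cast h1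
            linarith
        _ = ε / 2 := by rw [hη]; field_simp
    have h2 : ∑ t ∈ S.filter (fun t => ¬ t ∈ T₀), (if t ∈ T₀ then η else b ⌊t⌋) ≤ ε / 2 := by
      set R : Finset T := (S.filter (fun t => ¬ t ∈ T₀)).subtype (· ∈ T) with hR
      have hdisj : Disjoint R S₀ := by
        rw [Finset.disjoint_left]
        intro t ht htS
        rw [hR, Finset.mem_subtype, Finset.mem_filter] at ht
        exact ht.2 (Finset.mem_image_of_mem _ htS)
      have h3 := (le_abs_self _).trans (hS₀ R hdisj).le
      refine le_trans (le_of_eq ?_) h3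
      rw [hR, Finset.sum_subtype_of_mem (fun t => b ⌊t⌋)]
      · exact Finset.sum_congr rfl fun t ht => by rw [if_neg (Finset.mem_filter.1 ht).2]
      · intro t ht
        exact hS (Finset.mem_filter.1 ht).1
    linarith

/-- Continuous functions in the amalgam space `W(L^∞, ℓ¹)` belong to `L^p`. -/
theorem memLp_of_summable_iSup {g : ℝ → ℂ} (hgc : Continuous g)
    (hgW : Summable fun k : ℤ => ⨆ x : Set.Icc (k : ℝ) ((k : ℝ) + 1), ‖g (x : ℝ)‖)
    {p : ℝ} (hp : 1 ≤ p) : MemLp g (ENNReal.ofReal p) volume := by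
  set a : ℤ → ℝ := fun k => ⨆ x : Set.Icc (k : ℝ) ((k : ℝ) + 1), ‖g (x : ℝ)‖ with ha
  have ha0 : ∀ k, 0 ≤ a k := fun k => Real.iSup_nonneg fun _ => norm_nonneg _
  have hga : ∀ y, ‖g y‖ ≤ a ⌊y⌋ := norm_le_iSup_Icc_floor hgc
  have hp0 : 0 < p := by linarith
  rw [← integrable_norm_rpow_iff hgc.aestronglyMeasurable (by simpa using hp0) (by simp),
    ENNReal.toReal_ofReal hp0.le]
  set M : ℝ := ∑' k, a k
  have haM : ∀ k, a k ≤ M := fun k => hgW.le_tsum k fun j _ => ha0 j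
  have hcont : Continuous fun x => ‖g x‖ ^ p := hgc.norm.rpow_const fun _ => Or.inr hp0.le
  refine Real.integrable_of_summable_norm_Icc (f := ⟨_, hcont⟩) ?_
  refine Summable.of_nonneg_of_le (fun _ => norm_nonneg _) (fun k => ?_)
    ((hgW.mul_left (M ^ (p - 1))).add
      ((hgW.comp_injective (add_left_injective (1 : ℤ))).mul_left (M ^ (p - 1))))
  have hM0 : 0 ≤ M := (ha0 0).trans (haM 0)
  have hb : ∀ j, ∀ y, y ≤ a j → 0 ≤ y → y ^ p ≤ M ^ (p - 1) * a j := by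
    intro j y hy hy0
    rcases hy0.eq_or_lt with rfl | hy0
    · rw [Real.zero_rpow hp0.ne']; exact mul_nonneg (Real.rpow_nonneg hM0 _) (ha0 _)
    · calc y ^ p = y ^ (p - 1) * y := by rw [← Real.rpow_add_one hy0.ne']; ring_nf
        _ ≤ _ := by gcongr; exact hy.trans (haM j)
  rw [ContinuousMap.norm_le _ (by
    have := Real.rpow_nonneg hM0 (p - 1)
    have h1 := ha0 k
    have h2 := ha0 (k + 1)
    simp only [Function.comp_apply]; positivity)]
  rintro ⟨x, hx⟩
  simp only [ContinuousMap.restrict_apply, ContinuousMap.comp_apply, ContinuousMap.coe_mk,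
    ContinuousMap.coe_addRight, Function.comp_apply]
  rw [Real.norm_of_nonneg (by positivity)]
  have hk : k ≤ ⌊x + k⌋ := Int.le_floor.2 (by linarith [hx.1])
  have hk' : ⌊x + k⌋ ≤ k + 1 := by
    have := (Int.floor_le (x + k))
    have : (⌊x + k⌋ : ℝ) ≤ ((k + 1 : ℤ) : ℝ) := by push_cast; linarith [hx.2]
    exact_mod_cast this
  have h := hb _ _ (hga (x + k)) (norm_nonneg _)
  have h1 := mul_nonneg (Real.rpow_nonneg hM0 (p - 1)) (ha0 k)
  have h2 := mul_nonneg (Real.rpow_nonneg hM0 (p - 1)) (ha0 (k + 1))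
  rcases (by omega : ⌊x + k⌋ = k ∨ ⌊x + k⌋ = k + 1) with e | e <;> rw [e] at h <;> linarith

theorem eLpNorm_indicator_Ico {p L : ℝ} (hp : 0 < p) (hL : 0 ≤ L) {v : ℝ} (hv : 0 ≤ v)
    {μ : Measure ℝ} (hμ : μ (Set.Ico 0 L) = ENNReal.ofReal L) :
    eLpNorm ((Set.Ico 0 L).indicator fun _ => v) (ENNReal.ofReal p) μ =
      ENNReal.ofReal (v * L ^ (1 / p)) := by
  rw [eLpNorm_indicator_const measurableSet_Ico (by simpa using hp) (by simp), hμ,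
    ENNReal.toReal_ofReal hp.le, ENNReal.ofReal_rpow_of_nonneg hL (by positivity),
    ENNReal.ofReal_mul hv, Real.enorm_of_nonneg hv]

theorem ofReal_le_eLpNorm_restrict {p L ℓ v : ℝ} (hp : 0 < p) (hL : 0 ≤ L) (hLℓ : L ≤ ℓ)
    (hv : 0 ≤ v) {F : ℝ → ℂ} (hF : ∀ x ∈ Set.Ico 0 L, v ≤ ‖F x‖) :
    ENNReal.ofReal (v * L ^ (1 / p)) ≤
      eLpNorm F (ENNReal.ofReal p) (volume.restrict (Set.Icc 0 ℓ)) := by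
  have hμ : volume.restrict (Set.Icc 0 ℓ) (Set.Ico 0 L) = ENNReal.ofReal L := by
    rw [Measure.restrict_apply measurableSet_Ico, Set.inter_eq_left.2, Real.volume_Ico, sub_zero]
    exact fun x hx => ⟨hx.1, hx.2.le.trans hLℓ⟩
  rw [← eLpNorm_indicator_Ico hp hL hv hμ]
  refine eLpNorm_mono fun x => ?_
  by_cases hx : x ∈ Set.Ico 0 L
  · rw [Set.indicator_of_mem hx, Real.norm_of_nonneg hv]; exact hF x hx
  · rw [Set.indicator_of_notMem hx, norm_zero]; exact norm_nonneg _

theorem eLpNorm_le_ofReal_of_support {p L : ℝ} (hp : 0 < p) (hL : 0 ≤ L)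
    {f : ℝ → ℂ} (hf : ∀ x, ‖f x‖ ≤ 1) (hf0 : ∀ x, x ∉ Set.Ico 0 L → f x = 0) :
    eLpNorm f (ENNReal.ofReal p) volume ≤ ENNReal.ofReal (L ^ (1 / p)) := by
  rw [← one_mul (L ^ (1 / p)), ← eLpNorm_indicator_Ico hp hL zero_le_one
    (μ := volume) (by rw [Real.volume_Ico, sub_zero])]
  refine eLpNorm_mono fun x => ?_
  by_cases hx : x ∈ Set.Ico 0 L
  · rw [Set.indicator_of_mem hx, norm_one]; exact hf x
  · rw [hf0 x hx, norm_zero]; exact norm_nonneg _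

/-- Disjoint translates of a bump: the extremal example for `p < 2`. -/
theorem exists_bump {p ℓ d : ℝ} (hp : 0 < p) (hd : 0 < d) {n : ℕ} (hn : n * d ≤ ℓ) {a : ℕ → ℂ}
    (ha : ∀ k, ‖a k‖ = 1) :
    ∃ f : ℝ → ℂ, AEStronglyMeasurable f volume ∧
      eLpNorm f (ENNReal.ofReal p) volume ≤ ENNReal.ofReal (d ^ (1 / p)) ∧
      ENNReal.ofReal ((n * d) ^ (1 / p)) ≤
        eLpNorm (fun x => ∑ k ∈ Finset.range n, a k * f (x - k * d)) (ENNReal.ofReal p)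
          (volume.restrict (Set.Icc 0 ℓ)) := by
  refine ⟨(Set.Ico 0 d).indicator fun _ => 1,
    (measurable_const.indicator measurableSet_Ico).aestronglyMeasurable, ?_, ?_⟩
  · refine eLpNorm_le_ofReal_of_support hp hd.le (fun x => ?_)
      fun x hx => Set.indicator_of_notMem hx _
    exact (norm_indicator_le_norm_self _ _).trans (by simp)
  · rw [← one_mul ((n * d) ^ (1 / p))]
    refine ofReal_le_eLpNorm_restrict hp (by positivity) hn zero_le_one fun x hx => ?_
    have hxd : 0 ≤ x / d := div_nonneg hx.1 hd.le
    have hk : ⌊x / d⌋₊ ∈ Finset.range n := by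
      rw [Finset.mem_range, Nat.floor_lt hxd, div_lt_iff₀ hd]; exact hx.2
    rw [Finset.sum_eq_single_of_mem _ hk]
    · have h1 := (le_div_iff₀ hd).1 (Nat.floor_le hxd)
      have h2 := (div_lt_iff₀ hd).1 (Nat.lt_floor_add_one (x / d))
      rw [Set.indicator_of_mem (Set.mem_Ico.2 ⟨by linarith, by linarith⟩), mul_one, ha]
    · intro k _ hne
      rw [Set.indicator_of_notMem, mul_zero]
      rintro ⟨h1, h2⟩
      refine hne ((Nat.floor_eq_iff hxd).2 ⟨?_, ?_⟩).symm
      · rw [le_div_iff₀ hd]; linarith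
      · rw [div_lt_iff₀ hd]; linarith

/-- A step function focused by its own sign pattern: the extremal example for `p > 2`. -/
theorem exists_step {p ℓ d : ℝ} (hp : 0 < p) (hd : 0 < d) {n : ℕ} (hn : n * d ≤ ℓ) (hn1 : 1 ≤ n)
    {a : ℕ → ℂ} (ha : ∀ k, ‖a k‖ = 1) (haa : ∀ k, a k * a k = 1) :
    ∃ f : ℝ → ℂ, AEStronglyMeasurable f volume ∧
      eLpNorm f (ENNReal.ofReal p) volume ≤ ENNReal.ofReal ((n * d) ^ (1 / p)) ∧
      ENNReal.ofReal (n * d ^ (1 / p)) ≤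
        eLpNorm (fun x => ∑ k ∈ Finset.range n, a k * f (x - k * (-d))) (ENNReal.ofReal p)
          (volume.restrict (Set.Icc 0 ℓ)) := by
  refine ⟨(Set.Ico 0 (n * d)).indicator fun x => a ⌊x / d⌋₊, ?_, ?_, ?_⟩
  · refine (Measurable.indicator ?_ measurableSet_Ico).aestronglyMeasurable
    exact (measurable_from_nat (f := a)).comp (Nat.measurable_floor.comp (by fun_prop))
  · refine eLpNorm_le_ofReal_of_support hp (by positivity) (fun x => ?_)
      fun x hx => Set.indicator_of_notMem hx _
    exact (norm_indicator_le_norm_self _ _).trans (ha _).le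
  · have hdn : d ≤ n * d := le_mul_of_one_le_left hd.le (by exact_mod_cast hn1)
    refine ofReal_le_eLpNorm_restrict hp hd.le (hdn.trans hn) (Nat.cast_nonneg n) fun x hx => ?_
    have : ∑ k ∈ Finset.range n, a k *
        (Set.Ico 0 (n * d)).indicator (fun x => a ⌊x / d⌋₊) (x - k * (-d)) = n := by
      rw [Finset.sum_congr rfl (g := fun _ => 1), Finset.sum_const, Finset.card_range, nsmul_one]
      intro k hk
      have hkn : (k : ℝ) + 1 ≤ n := by exact_mod_cast Finset.mem_range.1 hk
      have h1 : x - k * (-d) ∈ Set.Ico 0 (n * d) := by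
        constructor
        · have := hx.1; have : 0 ≤ (k : ℝ) * d := by positivity
          linarith
        · have := mul_le_mul_of_nonneg_right hkn hd.le
          linarith [hx.2]
      rw [Set.indicator_of_mem h1]
      have h2 : ⌊(x - k * (-d)) / d⌋₊ = k := by
        rw [Nat.floor_eq_iff (div_nonneg h1.1 hd.le), le_div_iff₀ hd, div_lt_iff₀ hd]
        constructor <;> linarith [hx.1, hx.2]
      rw [h2, haa]
    rw [this]; simp

theorem coeFn_sum_smul_toLp {ι : Type*} {q : ℝ≥0∞} {u : ι → ℝ → ℂ} (hu : ∀ j, MemLp (u j) q volume)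
    (A : Finset ι) (a : ι → ℂ) :
    ⇑(∑ j ∈ A, a j • (hu j).toLp (u j)) =ᵐ[volume] fun x => ∑ j ∈ A, a j * u j x := by
  classical
  induction A using Finset.induction_on with
  | empty => exact Lp.coeFn_zero ℂ q volume
  | insert i A hi ih =>
    rw [Finset.sum_insert hi]
    filter_upwards [Lp.coeFn_add (a i • (hu i).toLp (u i)) (∑ j ∈ A, a j • (hu j).toLp (u j)),
      Lp.coeFn_smul (a i) ((hu i).toLp (u i)), (hu i).coeFn_toLp, ih] with x h1 h2 h3 h4
    rw [h1, Pi.add_apply, h2, Pi.smul_apply, h3, h4, Finset.sum_insert hi, smul_eq_mul]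

/-- No exponent above `1/2` beats square-root growth along powers of two. -/
theorem not_forall_two_pow_rpow_le {α K : ℝ} (hα : 1 / 2 < α) (hK : 0 ≤ K) :
    ¬ ∀ m : ℕ, ((2 : ℝ) ^ m) ^ α ≤ (Real.sqrt (2 * 2 ^ m) + 1) * K := by
  intro h
  have hlim : Tendsto (fun m : ℕ => ((2 : ℝ) ^ m) ^ (α - 1 / 2)) atTop atTop :=
    (tendsto_rpow_atTop (by linarith)).comp (tendsto_pow_atTop_atTop_of_one_lt (by norm_num))
  obtain ⟨m, hm⟩ := (hlim.eventually_gt_atTop (3 * K)).exists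
  have hpos : (0 : ℝ) < 2 ^ m := by positivity
  have h1 : (1 : ℝ) ≤ 2 ^ m := one_le_pow₀ (by norm_num)
  have hs1 : 1 ≤ Real.sqrt (2 ^ m) := Real.one_le_sqrt.2 h1
  have hs2 : Real.sqrt (2 * 2 ^ m) ≤ 2 * Real.sqrt (2 ^ m) := by
    rw [Real.sqrt_le_left (by positivity), mul_pow, Real.sq_sqrt hpos.le]; linarith
  have h2 := h m
  rw [show α = (α - 1 / 2) + 1 / 2 by ring, Real.rpow_add hpos, ← Real.sqrt_eq_rpow] at h2
  nlinarith [mul_le_mul_of_nonneg_right hs2 hK, mul_le_mul_of_nonneg_right hs1 hK,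
    mul_lt_mul_of_pos_right hm (by linarith : 0 < Real.sqrt (2 ^ m))]

/-- The character `x ↦ e^{2πisx}`. -/
def character (s x : ℝ) : ℂ := Complex.exp (2 * (Real.pi : ℂ) * Complex.I * ((s : ℂ) * (x : ℂ)))

theorem gabor_eq (g : ℝ → ℂ) (t s x : ℝ) : gabor g t s x = g (x - t) * character s x := rfl

theorem norm_character (s x : ℝ) : ‖character s x‖ = 1 := by
  have : character s x = Complex.exp (((2 * Real.pi * (s * x) : ℝ) : ℂ) * Complex.I) := by
    unfold character; congr 1; push_cast; ring
  rw [this, Complex.norm_exp_ofReal_mul_I]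

theorem character_add (s x y : ℝ) : character s (x + y) = character s x * character s y := by
  unfold character
  rw [← Complex.exp_add]; congr 1; push_cast; ring

theorem character_nat_mul (s : ℝ) (k : ℕ) (d : ℝ) :
    character s (k * d) = character s d ^ k := by
  unfold character
  rw [← Complex.exp_nat_mul]; congr 1; push_cast; ring

theorem continuous_character (s : ℝ) : Continuous (character s) := by
  unfold character; fun_prop

theorem continuous_gabor {g : ℝ → ℂ} (hgc : Continuous g) (t s : ℝ) : Continuous (gabor g t s) := by
  unfold gabor; fun_prop

theorem eLpNorm_comp_sub_right {q : ℝ≥0∞} {f : ℝ → ℂ} (hf : AEStronglyMeasurable f volume) (r : ℝ) :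
    eLpNorm (fun x => f (x - r)) q volume = eLpNorm f q volume :=
  eLpNorm_comp_measurePreserving hf (measurePreserving_sub_right volume r)

theorem memLp_gabor {g : ℝ → ℂ} {q : ℝ≥0∞} (hgc : Continuous g) (hg : MemLp g q volume) (t s : ℝ) :
    MemLp (gabor g t s) q volume := by
  refine (hg.comp_measurePreserving (measurePreserving_sub_right volume t)).of_le
    (continuous_gabor hgc t s).aestronglyMeasurable (Eventually.of_forall fun x => ?_)
  rw [gabor_eq, norm_mul, norm_character, mul_one]
  rfl

section Transference

variable {ι : Type*} {g : ℝ → ℂ} {q : ℝ≥0∞} {t s : ι → ℝ} {c : ι → ℂ} {R : ℝ}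

/-- The coefficient of each translate, a trigonometric polynomial, is locally bounded in `L^q`. -/
theorem eLpNorm_trigPoly_le [DecidableEq ι] (hgc : Continuous g) {δ ℓ x₀ : ℝ} (hδ : 0 < δ)
    (hgδ : ∀ x ∈ Set.Icc 0 ℓ, δ ≤ ‖g (x + x₀)‖)
    (hK : ∀ (A : Finset ι) (m : ι → ℂ) (B : ℝ), 0 < B → (∀ j, ‖m j‖ ≤ B) →
      eLpNorm (fun x => ∑ j ∈ A, m j * (c j * gabor g (t j) (s j) x)) q volume
        ≤ ENNReal.ofReal (B * R)) (A : Finset ι) (τ r : ℝ) :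
    eLpNorm (fun x => ∑ j ∈ A with t j = τ, c j * character (s j) (x - r)) q
      (volume.restrict (Set.Icc 0 ℓ)) ≤ ENNReal.ofReal (δ⁻¹ * R) := by
  set G : ℝ → ℂ := fun x => ∑ j ∈ A with t j = τ, c j * character (s j) (x - r) with hG
  set V : ℝ → ℂ := fun y => ∑ j ∈ A, (if t j = τ then character (s j) (-x₀ - τ - r) else 0) *
    (c j * gabor g (t j) (s j) y) with hV
  have hVm : AEStronglyMeasurable V volume := by
    refine Continuous.aestronglyMeasurable (continuous_finsetSum _ fun j _ => ?_)
    exact continuous_const.mul (continuous_const.mul (continuous_gabor hgc _ _))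
  have hVG : ∀ x, V (x - (-x₀ - τ)) = g (x + x₀) * G x := by
    intro x
    simp only [hV, hG]
    rw [Finset.sum_filter, Finset.mul_sum]
    refine Finset.sum_congr rfl fun j _ => ?_
    split_ifs with h
    · rw [gabor_eq, h, show x - r = (-x₀ - τ - r) + (x - (-x₀ - τ)) by ring, character_add,
        show x - (-x₀ - τ) - τ = x + x₀ by ring]
      ring
    · simp
  calc eLpNorm G q (volume.restrict (Set.Icc 0 ℓ))
      ≤ ENNReal.ofReal δ⁻¹ * eLpNorm (fun x => V (x - (-x₀ - τ))) q
          (volume.restrict (Set.Icc 0 ℓ)) := by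
        refine eLpNorm_le_mul_eLpNorm_of_ae_le_mul ?_ q
        refine (ae_restrict_iff' measurableSet_Icc).2 (Eventually.of_forall fun x hx => ?_)
        rw [hVG, norm_mul, ← mul_assoc]
        refine le_mul_of_one_le_left (norm_nonneg _) ?_
        rw [← div_eq_inv_mul, le_div_iff₀ hδ, one_mul]
        exact hgδ x hx
    _ ≤ ENNReal.ofReal δ⁻¹ * ENNReal.ofReal R := by
        gcongr
        refine (eLpNorm_mono_measure _ Measure.restrict_le_self).trans ?_
        rw [eLpNorm_comp_sub_right hVm]
        refine (hK A _ 1 one_pos fun j => ?_).trans (by rw [one_mul])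
        split_ifs
        · rw [norm_character]
        · simp
    _ = ENNReal.ofReal (δ⁻¹ * R) := (ENNReal.ofReal_mul (by positivity)).symm

/-- Transference: unconditionality bounds convolutions with measures of small support. -/
theorem eLpNorm_sum_translates_le (hq : 1 ≤ q) (hgc : Continuous g) {δ ℓ x₀ : ℝ} (hδ : 0 < δ)
    (hℓ : ℓ ≤ 1)
    (hgδ : ∀ x ∈ Set.Icc 0 ℓ, δ ≤ ‖g (x + x₀)‖) (hR : 0 ≤ R)
    (hK : ∀ (A : Finset ι) (m : ι → ℂ) (B : ℝ), 0 < B → (∀ j, ‖m j‖ ≤ B) →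
      eLpNorm (fun x => ∑ j ∈ A, m j * (c j * gabor g (t j) (s j) x)) q volume
        ≤ ENNReal.ofReal (B * R))
    {T : Set ℝ} (htT : ∀ j, t j ∈ T) {h₀ : ℝ} {w : ℝ → ℝ} {n : ℕ} (hw0 : ∀ t, 0 ≤ w t)
    (hw : ∀ t ∈ T, ∀ h, |h| ≤ h₀ → ∀ x ∈ Set.Icc (0 : ℝ) 1,
      ‖g (x - h - t) - g (x - t)‖ ≤ w t)
    (hwS : ∀ S : Finset ℝ, ↑S ⊆ T → n * ∑ t ∈ S, w t ≤ δ)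
    {a : ℕ → ℂ} (ha : ∀ k, ‖a k‖ ≤ 1) {B : ℝ} (hB : 0 < B)
    (haB : ∀ z : ℂ, ‖z‖ = 1 → ‖∑ k ∈ Finset.range n, a k * z ^ k‖ ≤ B)
    {d : ℝ} (hd : n * |d| ≤ h₀) {f : ℝ → ℂ} (hf : AEStronglyMeasurable f volume)
    (hsum : UncondSum q volume (fun j x => c j * gabor g (t j) (s j) x) f) :
    eLpNorm (fun x => ∑ k ∈ Finset.range n, a k * f (x - k * d)) q
      (volume.restrict (Set.Icc 0 ℓ)) ≤ ENNReal.ofReal ((B + 1) * R) := by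
  classical
  set F : Finset ι → ℝ → ℂ := fun A x => ∑ j ∈ A, c j * gabor g (t j) (s j) x with hF
  have hFc : ∀ A, Continuous (F A) := fun A => continuous_finsetSum _ fun j _ =>
    continuous_const.mul (continuous_gabor hgc _ _)
  have hbound : ∀ A, eLpNorm (fun x => ∑ k ∈ Finset.range n, a k * f (x - k * d)) q
      (volume.restrict (Set.Icc 0 ℓ)) ≤
      n * eLpNorm (fun x => F A x - f x) q volume + ENNReal.ofReal ((B + 1) * R) := by
    intro A
    set D : ℕ → ℝ → ℂ := fun k x => -a k * (F A (x - k * d) - f (x - k * d)) with hD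
    set M : ι → ℂ := fun j => ∑ k ∈ Finset.range n, a k * character (s j) (k * (-d)) with hM
    set P : ℝ → ℂ := fun x => ∑ j ∈ A, M j * (c j * gabor g (t j) (s j) x) with hP
    set Q : ℕ → ℝ → ℝ → ℂ := fun k τ x => a k * ((g (x - k * d - τ) - g (x - τ)) *
      ∑ j ∈ A with t j = τ, c j * character (s j) (x - k * d)) with hQ
    have hDm : ∀ k, AEStronglyMeasurable (D k) volume := fun k => by
      have hm : AEStronglyMeasurable (fun x => F A x - f x) volume :=
        (hFc A).aestronglyMeasurable.sub hf
      exact (hm.comp_measurePreserving (measurePreserving_sub_right volume _)).const_mul _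
    have hPc : Continuous P := continuous_finsetSum _ fun j _ =>
      continuous_const.mul (continuous_const.mul (continuous_gabor hgc _ _))
    have hQc : ∀ k τ, Continuous (Q k τ) := fun k τ => by
      refine continuous_const.mul (Continuous.mul (by fun_prop) ?_)
      exact continuous_finsetSum _ fun j _ => continuous_const.mul
        ((continuous_character _).comp (by fun_prop))
    have hdecomp : (fun x => ∑ k ∈ Finset.range n, a k * f (x - k * d)) =
        (∑ k ∈ Finset.range n, D k) + (P +
          ∑ k ∈ Finset.range n, ∑ τ ∈ A.image t, Q k τ) := by
      funext x
      simp only [Pi.add_apply, Finset.sum_apply]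
      have h1 : ∀ k, ∑ τ ∈ A.image t, Q k τ x = a k * ∑ j ∈ A,
          (g (x - k * d - t j) - g (x - t j)) * (c j * character (s j) (x - k * d)) := by
        intro k
        simp only [hQ]
        rw [← Finset.mul_sum, ← Finset.sum_fiberwise_of_maps_to (t := A.image t) (g := t)
          fun j hj => Finset.mem_image_of_mem _ hj]
        congr 1
        refine Finset.sum_congr rfl fun τ _ => ?_
        rw [Finset.mul_sum]
        refine Finset.sum_congr rfl fun j hj => ?_
        rw [(Finset.mem_filter.1 hj).2]
      have h2 : P x = ∑ k ∈ Finset.range n, a k * ∑ j ∈ A,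
          g (x - t j) * (c j * character (s j) (x - k * d)) := by
        simp only [hP, hM, Finset.sum_mul, Finset.mul_sum]
        rw [Finset.sum_comm]
        refine Finset.sum_congr rfl fun k _ => Finset.sum_congr rfl fun j _ => ?_
        rw [gabor_eq, show x - k * d = k * (-d) + x by ring, character_add]
        ring
      rw [h2, ← Finset.sum_add_distrib, ← Finset.sum_add_distrib]
      refine Finset.sum_congr rfl fun k _ => ?_
      rw [h1, ← mul_add, ← Finset.sum_add_distrib]
      have h3 : F A (x - k * d) = ∑ j ∈ A,
          (g (x - t j) * (c j * character (s j) (x - k * d)) +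
          (g (x - k * d - t j) - g (x - t j)) * (c j * character (s j) (x - k * d))) := by
        refine Finset.sum_congr rfl fun j _ => ?_
        rw [gabor_eq]; ring
      rw [← h3]
      simp only [hD]; ring
    set μ := volume.restrict (Set.Icc (0 : ℝ) ℓ) with hμ
    have hD1 : eLpNorm (∑ k ∈ Finset.range n, D k) q μ ≤
        n * eLpNorm (fun x => F A x - f x) q volume := by
      refine (eLpNorm_sum_le (fun k _ => (hDm k).restrict) hq).trans ?_
      rw [← nsmul_eq_mul]
      refine (Finset.sum_le_card_nsmul _ _ _ fun k _ => ?_).trans (by rw [Finset.card_range])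
      refine (eLpNorm_mono_measure _ Measure.restrict_le_self).trans ?_
      rw [← eLpNorm_comp_sub_right (f := fun x => F A x - f x)
        ((hFc A).aestronglyMeasurable.sub hf) (k * d)]
      refine eLpNorm_mono fun x => ?_
      simp only [hD]
      rw [norm_mul, norm_neg]
      exact mul_le_of_le_one_left (norm_nonneg _) (ha k)
    have hP1 : eLpNorm P q μ ≤ ENNReal.ofReal (B * R) := by
      refine (eLpNorm_mono_measure _ Measure.restrict_le_self).trans (hK A M B hB fun j => ?_)
      simp only [hM, character_nat_mul]
      exact haB _ (norm_character _ _)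
    have hQ1 : eLpNorm (∑ k ∈ Finset.range n, ∑ τ ∈ A.image t, Q k τ) q μ ≤ ENNReal.ofReal R := by
      have hQ2 : ∀ k ∈ Finset.range n, ∀ τ ∈ A.image t,
          eLpNorm (Q k τ) q μ ≤ ENNReal.ofReal (w τ * (δ⁻¹ * R)) := by
        intro k hk τ hτ
        rw [ENNReal.ofReal_mul (hw0 τ)]
        refine le_trans ?_ (mul_le_mul_right
          (eLpNorm_trigPoly_le hgc hδ hgδ hK A τ (k * d)) _)
        refine eLpNorm_le_mul_eLpNorm_of_ae_le_mul ?_ q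
        refine (ae_restrict_iff' measurableSet_Icc).2 (Eventually.of_forall fun x hx => ?_)
        simp only [hQ]
        rw [norm_mul, norm_mul]
        refine (mul_le_of_le_one_left (by positivity) (ha k)).trans ?_
        refine mul_le_mul_of_nonneg_right ?_ (norm_nonneg _)
        obtain ⟨j, _, rfl⟩ := Finset.mem_image.1 hτ
        refine hw _ (htT j) _ (le_trans ?_ hd) x ⟨hx.1, hx.2.trans hℓ⟩
        rw [abs_mul, Nat.abs_cast]
        have : (k : ℝ) ≤ n := by exact_mod_cast (Finset.mem_range.1 hk).le
        gcongr
      calc _ ≤ ∑ k ∈ Finset.range n, ∑ τ ∈ A.image t, eLpNorm (Q k τ) q μ :=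
            (eLpNorm_sum_le (fun k _ => Finset.aestronglyMeasurable_sum _ fun τ _ =>
              (hQc k τ).aestronglyMeasurable) hq).trans (Finset.sum_le_sum fun k _ =>
                eLpNorm_sum_le (fun τ _ => (hQc k τ).aestronglyMeasurable) hq)
        _ ≤ ∑ k ∈ Finset.range n, ∑ τ ∈ A.image t, ENNReal.ofReal (w τ * (δ⁻¹ * R)) :=
            Finset.sum_le_sum fun k hk => Finset.sum_le_sum fun τ hτ => hQ2 k hk τ hτ
        _ = ENNReal.ofReal (n * ∑ τ ∈ A.image t, w τ * (δ⁻¹ * R)) := by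
            rw [Finset.sum_const, Finset.card_range, nsmul_eq_mul,
              ENNReal.ofReal_mul (by positivity), ENNReal.ofReal_natCast,
              ENNReal.ofReal_sum_of_nonneg fun τ _ => by have := hw0 τ; positivity]
        _ ≤ ENNReal.ofReal R := by
            refine ENNReal.ofReal_le_ofReal ?_
            rw [← Finset.sum_mul, ← mul_assoc]
            have h1 := hwS (A.image t) (by
              intro τ hτ
              obtain ⟨j, _, rfl⟩ := Finset.mem_image.1 (Finset.mem_coe.1 hτ)
              exact htT j)
            calc _ ≤ δ * (δ⁻¹ * R) := mul_le_mul_of_nonneg_right h1 (by positivity)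
              _ = R := by rw [← mul_assoc, mul_inv_cancel₀ hδ.ne', one_mul]
    have hDm' : AEStronglyMeasurable (∑ k ∈ Finset.range n, D k) μ :=
      Finset.aestronglyMeasurable_sum _ fun k _ => (hDm k).restrict
    have hQm : AEStronglyMeasurable (∑ k ∈ Finset.range n, ∑ τ ∈ A.image t, Q k τ) μ :=
      Finset.aestronglyMeasurable_sum _ fun k _ => Finset.aestronglyMeasurable_sum _ fun τ _ =>
        (hQc k τ).aestronglyMeasurable
    rw [hdecomp, add_mul, one_mul, ENNReal.ofReal_add (by positivity) hR]
    exact (eLpNorm_add_le hDm' (hPc.aestronglyMeasurable.add hQm) hq).trans (add_le_add hD1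
      ((eLpNorm_add_le hPc.aestronglyMeasurable hQm hq).trans (add_le_add hP1 hQ1)))
  have hlim := (ENNReal.Tendsto.const_mul hsum (Or.inr (ENNReal.natCast_ne_top n))).add_const
    (ENNReal.ofReal ((B + 1) * R))
  rw [mul_zero, zero_add] at hlim
  exact ge_of_tendsto' hlim hbound

end Transference

section Frame

variable {ι : Type*} {g : ℝ → ℂ}

/-- Unconditional Gabor expansions obey a uniform multiplier bound. -/
theorem exists_gabor_multiplier_bound {q : ℝ≥0∞} [Fact (1 ≤ q)] (hgc : Continuous g)
    (hg : MemLp g q volume) (t s : ι → ℝ) (c : ι → Lp ℂ q (volume : Measure ℝ) →L[ℂ] ℂ)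
    (h : ∀ f : Lp ℂ q (volume : Measure ℝ),
      UncondSum q volume (fun j x => c j f * gabor g (t j) (s j) x) f) :
    ∃ K : ℝ, 0 ≤ K ∧ ∀ (A : Finset ι) (m : ι → ℂ) (B : ℝ), 0 < B → (∀ j, ‖m j‖ ≤ B) →
      ∀ f : Lp ℂ q (volume : Measure ℝ),
        eLpNorm (fun x => ∑ j ∈ A, m j * (c j f * gabor g (t j) (s j) x)) q volume
          ≤ ENNReal.ofReal (B * (K * ‖f‖)) := by
  have hu : ∀ j, MemLp (gabor g (t j) (s j)) q volume := fun j => memLp_gabor hgc hg _ _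
  obtain ⟨K, hK0, hK⟩ := exists_multiplier_bound c (fun j => (hu j).toLp _) fun f => by
    refine ⟨f, ?_⟩
    refine (Lp.tendsto_Lp_iff_tendsto_eLpNorm' _ _).2 ((h f).congr fun A => eLpNorm_congr_ae ?_)
    filter_upwards [coeFn_sum_smul_toLp hu A fun j => c j f] with x hx
    rw [Pi.sub_apply, hx]
  refine ⟨K, hK0, fun A m B hB hm f => ?_⟩
  have h1 := hK A m B hB hm f
  have h2 : ∑ j ∈ A, m j • (c j f • (hu j).toLp (gabor g (t j) (s j)))
      = ∑ j ∈ A, (m j * c j f) • (hu j).toLp (gabor g (t j) (s j)) :=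
    Finset.sum_congr rfl fun j _ => smul_smul _ _ _
  rw [h2, Lp.norm_def] at h1
  rw [eLpNorm_congr_ae (g := ⇑(∑ j ∈ A, (m j * c j f) • (hu j).toLp (gabor g (t j) (s j))))]
  · exact (ENNReal.le_ofReal_iff_toReal_le (Lp.eLpNorm_ne_top _) (by positivity)).2 h1
  · filter_upwards [coeFn_sum_smul_toLp hu A fun j => m j * c j f] with x hx
    rw [hx]
    exact Finset.sum_congr rfl fun j _ => (mul_assoc _ _ _).symm

/-- The window of a reproducing Gabor system does not vanish identically. -/
theorem exists_ne_zero_of_uncondSum {p : ℝ} [Fact ((1 : ℝ≥0∞) ≤ ENNReal.ofReal p)]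
    (hp : 0 < p) (t s : ι → ℝ)
    (c : ι → Lp ℂ (ENNReal.ofReal p) (volume : Measure ℝ) →L[ℂ] ℂ)
    (h : ∀ f : Lp ℂ (ENNReal.ofReal p) (volume : Measure ℝ),
      UncondSum (ENNReal.ofReal p) volume (fun j x => c j f * gabor g (t j) (s j) x) f) :
    ∃ x₀, g x₀ ≠ 0 := by
  by_contra! hg
  have hμ : volume (Set.Icc (0 : ℝ) 1) ≠ ∞ := by simp
  set f := indicatorConstLp (ENNReal.ofReal p) measurableSet_Icc hμ (1 : ℂ) with hf
  have h0 : eLpNorm f (ENNReal.ofReal p) volume = 0 := by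
    refine tendsto_nhds_unique (tendsto_const_nhds.congr fun A => ?_) (h f)
    rw [← eLpNorm_neg]
    congr 1
    funext x
    simp [gabor_eq, hg]
  have h1 : ‖f‖ = 0 := by rw [Lp.norm_def, h0, ENNReal.toReal_zero]
  rw [hf, norm_indicatorConstLp (by simpa using hp) (by simp)] at h1
  simp at h1

/-- A continuous function is bounded below near a point where it does not vanish. -/
theorem exists_lower_bound_of_ne_zero (hgc : Continuous g) {x₀ : ℝ} (hx₀ : g x₀ ≠ 0) :
    ∃ δ > (0 : ℝ), ∃ ℓ > (0 : ℝ), ℓ ≤ 1 ∧ ∀ x ∈ Set.Icc 0 ℓ, δ ≤ ‖g (x + x₀)‖ := by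
  have hpos : 0 < ‖g x₀‖ := norm_pos_iff.2 hx₀
  obtain ⟨r, hr, hgr⟩ := Metric.eventually_nhds_iff.1
    (hgc.norm.continuousAt.eventually_const_lt (half_lt_self hpos))
  refine ⟨‖g x₀‖ / 2, half_pos hpos, min 1 (r / 2), by positivity, min_le_left _ _,
    fun x hx => (hgr ?_).le⟩
  rw [Real.dist_eq, add_sub_cancel_right, abs_of_nonneg hx.1]
  linarith [hx.2.trans (min_le_right _ _)]

/-- A reproducing Gabor system makes convolution with a finely spaced Rudin–Shapiro measure nearly
as bounded as its Fourier transform. -/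
theorem exists_rudinShapiro_convolution_bound {q : ℝ≥0∞} [Fact (1 ≤ q)] (hgc : Continuous g)
    (hgW : Summable fun k : ℤ => ⨆ x : Set.Icc (k : ℝ) ((k : ℝ) + 1), ‖g (x : ℝ)‖)
    {T : Set ℝ} (hT : ∃ ρ > (0:ℝ), ∀ t ∈ T, ∀ t' ∈ T, t ≠ t' → ρ ≤ |t - t'|)
    {t s : ι → ℝ} (htT : ∀ j, t j ∈ T) (c : ι → Lp ℂ q (volume : Measure ℝ) →L[ℂ] ℂ)
    (h : ∀ f : Lp ℂ q (volume : Measure ℝ),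
      UncondSum q volume (fun j x => c j f * gabor g (t j) (s j) x) f)
    {K : ℝ} (hK0 : 0 ≤ K)
    (hK : ∀ (A : Finset ι) (m : ι → ℂ) (B : ℝ), 0 < B → (∀ j, ‖m j‖ ≤ B) →
      ∀ f : Lp ℂ q (volume : Measure ℝ),
        eLpNorm (fun x => ∑ j ∈ A, m j * (c j f * gabor g (t j) (s j) x)) q volume
          ≤ ENNReal.ofReal (B * (K * ‖f‖)))
    {δ ℓ x₀ : ℝ} (hδ : 0 < δ) (hℓ0 : 0 < ℓ) (hℓ1 : ℓ ≤ 1)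
    (hgδ : ∀ x ∈ Set.Icc 0 ℓ, δ ≤ ‖g (x + x₀)‖) (m : ℕ) :
    ∃ a : ℕ → ℂ, (∀ k, a k = 1 ∨ a k = -1) ∧ ∃ d > (0 : ℝ),
      (2 ^ m : ℕ) * d ≤ ℓ ∧ ∀ d', |d'| = d → ∀ f : ℝ → ℂ, AEStronglyMeasurable f volume →
        ∀ r : ℝ, 0 ≤ r → eLpNorm f q volume ≤ ENNReal.ofReal r →
        eLpNorm (fun x => ∑ k ∈ Finset.range (2 ^ m), a k * f (x - k * d')) q
          (volume.restrict (Set.Icc 0 ℓ)) ≤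
          ENNReal.ofReal ((Real.sqrt (2 * 2 ^ m) + 1) * (K * r)) := by
  have hq : 1 ≤ q := Fact.out
  obtain ⟨a, b, ha, _, hab⟩ := exists_rudinShapiro m
  have hn : (0 : ℝ) < (2 ^ m : ℕ) := by positivity
  obtain ⟨h₀, hh₀, w, hw0, hw, hwS⟩ := exists_summable_modulus hgc hgW hT (div_pos hδ hn)
  refine ⟨a, ha, min (h₀ / (2 ^ m : ℕ)) (ℓ / (2 ^ m : ℕ)), by positivity, ?_, ?_⟩
  · rw [mul_comm, ← le_div_iff₀ hn]; exact min_le_right _ _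
  · intro d' hd' f hf r hr hfr
    have hfm : MemLp f q volume := ⟨hf, hfr.trans_lt ENNReal.ofReal_lt_top⟩
    refine eLpNorm_sum_translates_le (c := fun j => c j (hfm.toLp f))
      (t := t) (s := s) (T := T)
      hq hgc hδ hℓ1 hgδ (by positivity) ?_
      htT hw0 hw ?_ ?_ (by positivity) ?_ ?_ hf ?_ (n := 2 ^ m) (h₀ := h₀)
    · intro A M B hB hM
      refine (hK A M B hB hM _).trans (ENNReal.ofReal_le_ofReal ?_)
      have : ‖hfm.toLp f‖ ≤ r := by
        rw [Lp.norm_toLp]; exact ENNReal.toReal_le_of_le_ofReal hr hfr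
      gcongr
    · intro S hS
      have := hwS S hS
      rwa [le_div_iff₀' hn] at this
    · intro k
      rcases ha k with h | h <;> simp [h]
    · intro z hz
      refine Real.le_sqrt_of_sq_le ?_
      rw [← hab z hz]
      exact le_add_of_nonneg_right (sq_nonneg _)
    · rw [hd', mul_comm, ← le_div_iff₀ hn]; exact min_le_left _ _
    · refine (h (hfm.toLp f)).congr fun A => eLpNorm_congr_ae ?_
      filter_upwards [hfm.coeFn_toLp] with x hx
      rw [hx]

end Frame

/-- Balian–Low type. Let `1 < p < ∞`, `p ≠ 2`, and let `g` be a
continuous function in the Wiener amalgam space `W(L^∞, ℓ¹)`. If `Λ ⊆ T × ℝ` is countable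
with `T ⊆ ℝ` uniformly discrete, then no Gabor system `((e_s τ_t g, g*_{ts}))_{(t,s)∈Λ}`
forms an unconditional Schauder frame for `L^p(ℝ;ℂ)`. -/
theorem stmt_4 (p : ℝ) (hp1 : 1 < p) (hp2 : p ≠ 2) [Fact ((1 : ℝ≥0∞) ≤ ENNReal.ofReal p)]
    (g : ℝ → ℂ) (hgc : Continuous g)
    (hgW : Summable fun k : ℤ => ⨆ x : Set.Icc (k : ℝ) ((k : ℝ) + 1), ‖g (x : ℝ)‖)
    (T : Set ℝ) (hT : ∃ ρ > (0:ℝ), ∀ t ∈ T, ∀ t' ∈ T, t ≠ t' → ρ ≤ |t - t'|)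
    (Λ : Set (ℝ × ℝ)) (hΛ : Λ.Countable) (hsub : ∀ ts ∈ Λ, Prod.fst ts ∈ T)
    (gs : Λ → (Lp ℂ (ENNReal.ofReal p) (volume : Measure ℝ) →L[ℂ] ℂ)) :
    ¬ ∀ f : Lp ℂ (ENNReal.ofReal p) (volume : Measure ℝ),
        UncondSum (ENNReal.ofReal p) volume
          (fun j x => gs j f * gabor g (j : ℝ × ℝ).1 (j : ℝ × ℝ).2 x) (⇑f) := by
  intro h
  have hp0 : 0 < p := by linarith
  have hgq : MemLp g (ENNReal.ofReal p) volume :=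
    memLp_of_summable_iSup hgc hgW hp1.le
  obtain ⟨K, hK0, hK⟩ := exists_gabor_multiplier_bound hgc hgq _ _ gs h
  obtain ⟨x₀, hx₀⟩ := exists_ne_zero_of_uncondSum hp0 _ _ gs h
  obtain ⟨δ, hδ, ℓ, hℓ0, hℓ1, hgδ⟩ := exists_lower_bound_of_ne_zero hgc hx₀
  have htest := exists_rudinShapiro_convolution_bound hgc hgW hT
    (fun j : Λ => hsub _ j.2) gs h hK0 hK hδ hℓ0 hℓ1 hgδ
  rcases hp2.lt_or_gt with hp | hp
  · refine not_forall_two_pow_rpow_le (α := 1 / p) (one_div_lt_one_div_of_lt hp0 hp) hK0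
      fun m => ?_
    obtain ⟨a, ha, d, hd, hdℓ, hm⟩ := htest m
    obtain ⟨f, hf, hfn, hfU⟩ := exists_bump hp0 hd hdℓ (a := a) fun k => by
      rcases ha k with h | h <;> simp [h]
    have h1 := hfU.trans (hm d (abs_of_pos hd) f hf _ (by positivity) hfn)
    rw [ENNReal.ofReal_le_ofReal_iff (by positivity), Real.mul_rpow (by positivity) hd.le,
      ← mul_assoc] at h1
    simpa using le_of_mul_le_mul_right h1 (by positivity)
  · have hp' : 1 / p < 1 / 2 := one_div_lt_one_div_of_lt two_pos hp
    refine not_forall_two_pow_rpow_le (α := 1 - 1 / p) (by linarith) hK0 fun m => ?_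
    obtain ⟨a, ha, d, hd, hdℓ, hm⟩ := htest m
    obtain ⟨f, hf, hfn, hfU⟩ := exists_step hp0 hd hdℓ Nat.one_le_two_pow (a := a)
      (fun k => by rcases ha k with h | h <;> simp [h])
      (fun k => by rcases ha k with h | h <;> simp [h])
    have h1 := hfU.trans (hm (-d) (by rw [abs_neg, abs_of_pos hd]) f hf _ (by positivity) hfn)
    rw [ENNReal.ofReal_le_ofReal_iff (by positivity), Real.mul_rpow (by positivity) hd.le,
      ← mul_assoc, ← mul_assoc] at h1
    have h2 := le_of_mul_le_mul_right h1 (by positivity)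
    have hpos : (0 : ℝ) < 2 ^ m := by positivity
    rw [Real.rpow_sub hpos, Real.rpow_one, div_le_iff₀ (by positivity)]
    simpa using h2
end
end

section
/- For every δ > 0 there exists a constant C(δ) > 0 with the following property. Let S ⊂ ℝ be a countable set, and for l ∈ ℤ put S_l = S ∩ [lδ, (l+1)δ). Let (a_s)_{s∈S} be complex scalars such that Q := (Σ_{l∈ℤ} (Σ_{s∈S_l} |a_s|)²)^{1/2} < ∞. Then for every interval I ⊂ ℝ of length 1, the family (a_s·e_s)_{s∈S}, where e_s(x) = e^{2πisx}, is unconditionally summable in L²(I;ℂ) and its sum F satisfies ‖F‖_{L²(I)} ≤ C(δ)·Q. -/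
open MeasureTheory Filter
open scoped ENNReal

noncomputable section

open Finset in
/-- A form of Schur's test on a finite index set, blocked along `n : ι → ℤ`. -/
theorem sum_sum_mul_kernel_le {ι : Type*} (n : ι → ℤ) (x : ι → ℝ) {K : ℤ → ℝ}
    (hK : ∀ k, 0 ≤ K k) (hKs : Summable K) (A : Finset ι) :
    ∑ i ∈ A, ∑ j ∈ A, x i * x j * K (n i - n j) ≤
      (∑' k, K k) * ∑ i ∈ A, ∑ j ∈ A, if n i = n j then x i * x j else 0 := by
  classical
  set L := A.image n
  set X : ℤ → ℝ := fun l => ∑ i ∈ A with n i = l, x i with hX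
  have fiber : ∀ g : ℤ → ℝ, ∑ i ∈ A, x i * g (n i) = ∑ l ∈ L, X l * g l := fun g => by
    rw [← sum_fiberwise_of_maps_to (fun i hi => mem_image_of_mem n hi)]
    refine sum_congr rfl fun l _ => ?_
    rw [hX, sum_mul]
    refine sum_congr rfl fun i hi => ?_
    rw [(mem_filter.mp hi).2]
  have lhs : ∑ i ∈ A, ∑ j ∈ A, x i * x j * K (n i - n j) =
      ∑ l ∈ L, ∑ m ∈ L, X l * X m * K (l - m) := by
    simp only [mul_assoc, ← mul_sum]
    rw [← fiber fun l => ∑ m ∈ L, X m * K (l - m)]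
    exact sum_congr rfl fun i _ => by rw [fiber fun m => K (n i - m)]
  have rhs : ∑ i ∈ A, ∑ j ∈ A, (if n i = n j then x i * x j else 0) = ∑ l ∈ L, X l ^ 2 := by
    simp only [pow_two]
    rw [← fiber X]
    refine sum_congr rfl fun i _ => ?_
    rw [hX, mul_sum, sum_filter]
    simp only [eq_comm]
  have row : ∀ l, ∑ m ∈ L, K (l - m) ≤ ∑' k, K k := fun l => by
    rw [← (Equiv.subLeft l).tsum_eq K]
    exact ((Equiv.subLeft l).summable_iff.mpr hKs).sum_le_tsum L fun _ _ => hK _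
  have col : ∀ m, ∑ l ∈ L, K (l - m) ≤ ∑' k, K k := fun m => by
    rw [← (Equiv.subRight m).tsum_eq K]
    exact ((Equiv.subRight m).summable_iff.mpr hKs).sum_le_tsum L fun _ _ => hK _
  rw [lhs, rhs]
  calc ∑ l ∈ L, ∑ m ∈ L, X l * X m * K (l - m)
      ≤ ∑ l ∈ L, ∑ m ∈ L, (X l ^ 2 / 2 * K (l - m) + X m ^ 2 / 2 * K (l - m)) := by
        refine sum_le_sum fun l _ => sum_le_sum fun m _ => ?_
        rw [← add_mul]
        exact mul_le_mul_of_nonneg_right (by nlinarith [sq_nonneg (X l - X m)]) (hK _)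
    _ = ∑ l ∈ L, X l ^ 2 / 2 * ∑ m ∈ L, K (l - m) +
          ∑ m ∈ L, X m ^ 2 / 2 * ∑ l ∈ L, K (l - m) := by
        simp only [sum_add_distrib, mul_sum]
        congr 1
        exact sum_comm
    _ ≤ ∑ l ∈ L, X l ^ 2 / 2 * ∑' k, K k + ∑ m ∈ L, X m ^ 2 / 2 * ∑' k, K k := by
        gcongr
        · exact row _
        · exact col _
    _ = (∑' k, K k) * ∑ l ∈ L, X l ^ 2 := by
        rw [← sum_add_distrib, mul_sum]
        exact sum_congr rfl fun l _ => by ring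

/-- A family in a Hilbert space whose Gram matrix is dominated by a summable convolution kernel
between blocks is summable as soon as its block coefficients lie in `ℓ²(ℓ¹)`. -/
theorem summable_and_norm_tsum_sq_le_of_norm_inner_le {ι E : Type*} [NormedAddCommGroup E]
    [InnerProductSpace ℂ E] [CompleteSpace E] (f : ι → E) (n : ι → ℤ) (x : ι → NNReal)
    {K : ℤ → ℝ} (hK : ∀ k, 0 ≤ K k) (hKs : Summable K)
    (hf : ∀ i j, ‖inner ℂ (f i) (f j)‖ ≤ x i * x j * K (n i - n j))
    (hx : Summable fun p : ι × ι => if n p.1 = n p.2 then x p.1 * x p.2 else 0) :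
    Summable f ∧ ‖∑' i, f i‖ ^ 2 ≤
      (∑' k, K k) * ((∑' p : ι × ι, if n p.1 = n p.2 then x p.1 * x p.2 else 0 : NNReal) : ℝ) := by
  classical
  set G : ι × ι → NNReal := fun p => if n p.1 = n p.2 then x p.1 * x p.2 else 0 with hG
  have hC : 0 ≤ ∑' k, K k := tsum_nonneg hK
  have bound : ∀ A : Finset ι, ‖∑ i ∈ A, f i‖ ^ 2 ≤ (∑' k, K k) * ∑ p ∈ A ×ˢ A, (G p : ℝ) := by
    intro A
    have h1 : ‖∑ i ∈ A, f i‖ ^ 2 ≤ ∑ i ∈ A, ∑ j ∈ A, (x i * x j * K (n i - n j) : ℝ) := by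
      rw [← Complex.norm_of_nonneg (sq_nonneg ‖∑ i ∈ A, f i‖), Complex.ofReal_pow,
        ← Complex.coe_algebraMap, ← inner_self_eq_norm_sq_to_K (𝕜 := ℂ), sum_inner]
      refine norm_sum_le_of_le _ fun i _ => ?_
      rw [inner_sum]
      exact norm_sum_le_of_le _ fun j _ => hf i j
    refine h1.trans ((sum_sum_mul_kernel_le n (fun i => (x i : ℝ)) hK hKs A).trans_eq ?_)
    rw [Finset.sum_product]
    simp only [hG, apply_ite NNReal.toReal, NNReal.coe_mul, NNReal.coe_zero]
  have hx' : Summable fun p => (G p : ℝ) := NNReal.summable_coe.mpr hx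
  have hsum : Summable f := by
    rw [summable_iff_vanishing_norm]
    intro ε hε
    obtain ⟨P, hP⟩ := summable_iff_vanishing_norm.mp hx' (ε ^ 2 / (∑' k, K k + 1)) (by positivity)
    refine ⟨P.image Prod.fst, fun t ht => ?_⟩
    have hdisj : Disjoint (t ×ˢ t) P := by
      rw [Finset.disjoint_left] at ht ⊢
      exact fun p hp hpP => ht (Finset.mem_product.mp hp).1 (Finset.mem_image_of_mem _ hpP)
    have h1 := (le_abs_self _).trans_lt (hP _ hdisj)
    rw [lt_div_iff₀ (by positivity)] at h1
    have h2 : 0 ≤ ∑ p ∈ t ×ˢ t, (G p : ℝ) := Finset.sum_nonneg fun p _ => (G p).2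
    exact lt_of_pow_lt_pow_left₀ 2 hε.le (by nlinarith [bound t])
  refine ⟨hsum, le_of_tendsto' (hsum.hasSum.norm.pow 2) fun A => (bound A).trans ?_⟩
  rw [NNReal.coe_tsum]
  exact mul_le_mul_of_nonneg_left (hx'.sum_le_tsum _ fun p _ => (G p).2) hC

/-- The squared `ℓ²(ℓ¹)` norm over the fibres of `n`, written as a sum over pairs. -/
theorem tsum_sq_tsum_fiber_eq {ι κ : Type*} [DecidableEq κ] (n : ι → κ) (x : ι → ℝ≥0∞) :
    ∑' l, (∑' i : {i // n i = l}, x i) ^ 2 =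
      ∑' p : ι × ι, if n p.1 = n p.2 then x p.1 * x p.2 else 0 := by
  have h : ∀ l, (∑' i : {i // n i = l}, x i) = ∑' i, if n i = l then x i else 0 := fun l => by
    refine (tsum_subtype {i | n i = l} x).trans ?_
    simp only [Set.indicator_apply, Set.mem_ofPred_eq]
  simp_rw [h, pow_two, ← ENNReal.tsum_mul_right, ← ENNReal.tsum_mul_left, ENNReal.tsum_prod']
  rw [ENNReal.tsum_comm]
  refine tsum_congr fun i => ?_
  rw [ENNReal.tsum_comm]
  refine tsum_congr fun j => ?_
  rw [tsum_eq_single (n i) fun l hl => by simp [hl.symm]]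
  simp only [if_true, mul_ite, mul_zero, eq_comm]

theorem summable_pow_natAbs {r : ℝ} (h0 : 0 ≤ r) (h1 : r < 1) :
    Summable fun k : ℤ => r ^ k.natAbs :=
  .of_nat_of_neg (by simpa using summable_geometric_of_lt_one h0 h1)
    (by simpa using summable_geometric_of_lt_one h0 h1)

open ProbabilityTheory in
theorem restrict_Icc_le_smul_gaussianReal (b : ℝ) :
    volume.restrict (Set.Icc b (b + 1)) ≤
      ENNReal.ofReal (√(2 * Real.pi) * Real.exp (1 / 2)) • gaussianReal b 1 := by
  rw [gaussianReal_of_var_ne_zero b one_ne_zero, ← withDensity_smul _ (measurable_gaussianPDF b 1),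
    ← withDensity_indicator_one measurableSet_Icc]
  refine withDensity_mono (ae_of_all _ fun x => ?_)
  by_cases hx : x ∈ Set.Icc b (b + 1)
  · have hpi : 0 < √(2 * Real.pi) := by positivity
    rw [Set.indicator_of_mem hx, Pi.smul_apply, smul_eq_mul, gaussianPDF, Pi.one_apply,
      ← ENNReal.ofReal_mul (by positivity), ENNReal.one_le_ofReal, gaussianPDFReal]
    simp only [NNReal.coe_one, mul_one]
    rw [mul_mul_mul_comm, mul_inv_cancel₀ hpi.ne', one_mul, ← Real.exp_add, Real.one_le_exp_iff]
    nlinarith [hx.1, hx.2]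
  · simp [Set.indicator_of_notMem hx]

open ProbabilityTheory in
/-- Exponentials have Gaussian correlations with respect to a Gaussian measure. -/
theorem norm_integral_exp_gaussianReal (b t : ℝ) :
    ‖∫ x : ℝ, Complex.exp (2 * (Real.pi : ℂ) * Complex.I * ((t : ℂ) * (x : ℂ)))
      ∂gaussianReal b 1‖ = Real.exp (-(2 * Real.pi ^ 2 * t ^ 2)) := by
  have h : ∀ x : ℝ, Complex.exp (2 * (Real.pi : ℂ) * Complex.I * ((t : ℂ) * (x : ℂ))) =
      Complex.exp ((2 * Real.pi * t : ℝ) * x * Complex.I) := fun x => by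
    push_cast
    ring_nf
  simp_rw [h]
  rw [← charFun_apply_real, charFun_gaussianReal]
  have hexp : ((2 * Real.pi * t : ℝ) : ℂ) * b * Complex.I -
      ((1 : NNReal) : ℂ) * ((2 * Real.pi * t : ℝ) : ℂ) ^ 2 / 2 =
      ((-(2 * Real.pi ^ 2 * t ^ 2) : ℝ) : ℂ) + ((2 * Real.pi * t * b : ℝ) : ℂ) * Complex.I := by
    push_cast
    ring
  rw [hexp, Complex.norm_exp, Complex.add_re, Complex.ofReal_re, Complex.re_ofReal_mul,
    Complex.I_re, mul_zero, add_zero]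

theorem exp_neg_le_kernel {δ : ℝ} (hδ : 0 < δ) (s t : ℝ) :
    Real.exp (-(2 * Real.pi ^ 2 * (s - t) ^ 2)) ≤
      Real.exp (2 * Real.pi ^ 2 * δ ^ 2) *
        Real.exp (-(Real.pi ^ 2 * δ ^ 2)) ^ (⌊s / δ⌋ - ⌊t / δ⌋).natAbs := by
  set k := ⌊s / δ⌋ - ⌊t / δ⌋ with hk
  have hs1 := Int.floor_le (s / δ)
  have hs2 := Int.lt_floor_add_one (s / δ)
  have ht1 := Int.floor_le (t / δ)
  have ht2 := Int.lt_floor_add_one (t / δ)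
  have hd : |(k : ℝ) - (s - t) / δ| ≤ 1 := by
    rw [sub_div, abs_le, hk, Int.cast_sub]
    constructor <;> linarith
  have hk1 : (k.natAbs : ℝ) ≤ (k : ℝ) ^ 2 := by
    rw [← Int.cast_natCast, Int.natCast_natAbs]
    rw [← sq_abs (k : ℝ), ← Int.cast_abs]
    exact_mod_cast Int.le_self_sq |k|
  have hk2 : (k : ℝ) ^ 2 ≤ 2 * ((s - t) / δ) ^ 2 + 2 := by
    have := (sq_le_one_iff_abs_le_one _).mpr hd
    nlinarith [sq_nonneg ((k : ℝ) - 2 * ((s - t) / δ))]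
  have hdiv : ((s - t) / δ) ^ 2 * δ ^ 2 = (s - t) ^ 2 := by field_simp
  rw [← Real.exp_nat_mul, ← Real.exp_add, Real.exp_le_exp, ← hdiv]
  have hp : 0 < Real.pi ^ 2 * δ ^ 2 := by positivity
  nlinarith [mul_le_mul_of_nonneg_left (hk1.trans hk2) hp.le]

open ProbabilityTheory in
theorem memLp_const_mul_exp_gaussianReal (b s : ℝ) (c : ℂ) :
    MemLp (fun x : ℝ => c * Complex.exp (2 * (Real.pi : ℂ) * Complex.I * ((s : ℂ) * (x : ℂ)))) 2
      (gaussianReal b 1) := by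
  refine MemLp.of_bound (Measurable.aestronglyMeasurable (by fun_prop)) ‖c‖ (ae_of_all _ fun x => ?_)
  simp [Complex.norm_exp]

open ProbabilityTheory in
theorem norm_inner_toLp_const_mul_exp (b s t : ℝ) (c d : ℂ) :
    ‖inner ℂ (memLp_const_mul_exp_gaussianReal b s c).toLp
        (memLp_const_mul_exp_gaussianReal b t d).toLp‖ =
      ‖c‖ * ‖d‖ * Real.exp (-(2 * Real.pi ^ 2 * (s - t) ^ 2)) := by
  rw [L2.inner_def, ← neg_sub t s, neg_sq, ← norm_integral_exp_gaussianReal b (t - s),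
    ← norm_star c, ← norm_mul, ← norm_mul, ← integral_const_mul]
  congr 1
  refine integral_congr_ae ?_
  filter_upwards [(memLp_const_mul_exp_gaussianReal b s c).coeFn_toLp,
    (memLp_const_mul_exp_gaussianReal b t d).coeFn_toLp] with x hx hy
  rw [hx, hy]
  have : Complex.exp (2 * (Real.pi : ℂ) * Complex.I * (((t - s : ℝ) : ℂ) * (x : ℂ))) =
      Complex.exp (2 * (Real.pi : ℂ) * Complex.I * ((t : ℂ) * (x : ℂ))) *
      Complex.exp (-(2 * (Real.pi : ℂ) * Complex.I * ((s : ℂ) * (x : ℂ)))) := by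
    rw [← Complex.exp_add]
    push_cast
    ring_nf
  rw [this]
  simp only [RCLike.inner_apply, map_mul, ← Complex.exp_conj, Complex.conj_ofReal, Complex.conj_I,
    map_ofNat, RCLike.star_def]
  ring_nf

/-- A Bessel-type bound for exponentials on a unit interval: if the
coefficients satisfy `Σ_{l∈ℤ} (Σ_{s∈S_l} |a_s|)² < ∞` (blocks `S_l = S ∩ [lδ,(l+1)δ)`),
then `(a_s e_s)_{s∈S}` is unconditionally summable in `L²(I)` for every unit interval `I`,
with sum of `L²(I)` norm at most `C(δ)·(Σ_l (Σ_{s∈S_l} |a_s|)²)^{1/2}`. -/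
theorem stmt_13 (δ : ℝ) (hδ : 0 < δ) :
    ∃ C : ℝ, 0 < C ∧
      ∀ (S : Set ℝ), S.Countable → ∀ a : S → ℂ,
        (∑' l : ℤ, (∑' s : {s : S // (l : ℝ) * δ ≤ (s : ℝ) ∧ (s : ℝ) < ((l : ℝ) + 1) * δ},
            (‖a (s : S)‖₊ : ℝ≥0∞)) ^ 2) < ⊤ →
        ∀ b : ℝ, ∃ F : ℝ → ℂ,
          UncondSum 2 (volume.restrict (Set.Icc b (b + 1)))
            (fun s : S => fun x =>
              a s * Complex.exp (2 * (Real.pi : ℂ) * Complex.I * (((s : ℝ) : ℂ) * (x : ℂ)))) F ∧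
          eLpNorm F 2 (volume.restrict (Set.Icc b (b + 1))) ≤
            ENNReal.ofReal C *
              (∑' l : ℤ, (∑' s : {s : S // (l : ℝ) * δ ≤ (s : ℝ) ∧ (s : ℝ) < ((l : ℝ) + 1) * δ},
                (‖a (s : S)‖₊ : ℝ≥0∞)) ^ 2) ^ ((1 : ℝ) / 2) := by
  set r : ℝ := Real.exp (-(Real.pi ^ 2 * δ ^ 2))
  set K : ℤ → ℝ := fun k => Real.exp (2 * Real.pi ^ 2 * δ ^ 2) * r ^ k.natAbs
  have hK : ∀ k, 0 ≤ K k := fun k => by positivity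
  have hKs : Summable K :=
    (summable_pow_natAbs (Real.exp_nonneg _) (Real.exp_lt_one_iff.mpr (by
      have : 0 < Real.pi ^ 2 * δ ^ 2 := by positivity
      linarith))).mul_left _
  have hC : 0 < ∑' k, K k := hKs.tsum_pos hK 0 (by positivity)
  set M : ℝ := √(2 * Real.pi) * Real.exp (1 / 2) with hM
  have hM0 : 0 < M := by positivity
  refine ⟨√M * √(∑' k, K k), by positivity, fun S _ a hQ b => ?_⟩
  set n : S → ℤ := fun s => ⌊(s : ℝ) / δ⌋ with hn
  have hblock : ∀ (l : ℤ) (s : S),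
      n s = l ↔ ((l : ℝ) * δ ≤ (s : ℝ) ∧ (s : ℝ) < ((l : ℝ) + 1) * δ) := fun l s => by
    rw [hn, Int.floor_eq_iff, le_div_iff₀ hδ, div_lt_iff₀ hδ]
  have hQ_eq : (∑' l : ℤ, (∑' s : {s : S // (l : ℝ) * δ ≤ (s : ℝ) ∧ (s : ℝ) < ((l : ℝ) + 1) * δ},
      (‖a (s : S)‖₊ : ℝ≥0∞)) ^ 2) =
      ∑' p : S × S, ((if n p.1 = n p.2 then ‖a p.1‖₊ * ‖a p.2‖₊ else 0 : NNReal) : ℝ≥0∞) := by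
    rw [← tsum_congr fun l => congrArg (· ^ 2) ((Equiv.subtypeEquivRight (hblock l)).tsum_eq
      fun s => (‖a (s : S)‖₊ : ℝ≥0∞))]
    refine (tsum_sq_tsum_fiber_eq n fun s => (‖a s‖₊ : ℝ≥0∞)).trans (tsum_congr fun p => ?_)
    split_ifs <;> simp
  rw [hQ_eq] at hQ ⊢
  have hG := ENNReal.tsum_coe_ne_top_iff_summable.mp hQ.ne
  rw [← ENNReal.coe_tsum hG]
  set ν := ProbabilityTheory.gaussianReal b 1 with hν
  have hmem := fun s : S => memLp_const_mul_exp_gaussianReal b s (a s)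
  set f : S → Lp ℂ 2 ν := fun s => (hmem s).toLp
  obtain ⟨hsum, hbound⟩ := summable_and_norm_tsum_sq_le_of_norm_inner_le f n (fun s => ‖a s‖₊)
    hK hKs (fun s t => (norm_inner_toLp_const_mul_exp b s t (a s) (a t)).trans_le
      (mul_le_mul_of_nonneg_left (exp_neg_le_kernel hδ s t) (by positivity))) hG
  have hle : ∀ g : ℝ → ℂ, eLpNorm g 2 (volume.restrict (Set.Icc b (b + 1))) ≤
      ENNReal.ofReal √M * eLpNorm g 2 ν := fun g => by
    refine (eLpNorm_le_of_measure_le_smul (restrict_Icc_le_smul_gaussianReal b)).trans_eq ?_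
    rw [smul_eq_mul, ← hM, Real.sqrt_eq_rpow M, ← ENNReal.ofReal_rpow_of_pos hM0]
    norm_num [hν]
  refine ⟨(∑' s, f s : Lp ℂ 2 ν), ?_, ?_⟩
  · have hlim : Tendsto (fun A : Finset S => ENNReal.ofReal √M *
        ‖∑ s ∈ A, f s - ∑' s, f s‖ₑ) atTop (nhds 0) := by
      have := tendsto_iff_enorm_sub_tendsto_zero.mp hsum.hasSum
      simpa using ENNReal.Tendsto.const_mul this (Or.inr ENNReal.ofReal_ne_top)
    refine tendsto_of_tendsto_of_tendsto_of_le_of_le tendsto_const_nhds hlim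
      (fun _ => zero_le) fun A => (hle _).trans_eq ?_
    rw [Lp.enorm_def]
    congr 1
    refine eLpNorm_congr_ae ?_
    have hall : ∀ᵐ x ∂ν, ∀ s ∈ A, f s x = a s * Complex.exp
        (2 * (Real.pi : ℂ) * Complex.I * (((s : ℝ) : ℂ) * (x : ℂ))) :=
      (ae_ball_iff A.countable_toSet).mpr fun s _ => (hmem s).coeFn_toLp
    filter_upwards [hall, Lp.coeFn_sub (∑ s ∈ A, f s) (∑' s, f s), Lp.coeFn_finsetSum A f]
      with x h1 h2 h3
    rw [h2, Pi.sub_apply, h3, Finset.sum_apply, Finset.sum_congr rfl h1]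
  · refine (hle _).trans ?_
    rw [← Lp.enorm_def, ← ofReal_norm, ENNReal.ofReal_mul (Real.sqrt_nonneg _), mul_assoc]
    gcongr
    rw [← ENNReal.ofReal_coe_nnreal,
      ENNReal.ofReal_rpow_of_nonneg (NNReal.coe_nonneg _) (by norm_num), ← Real.sqrt_eq_rpow, ← ENNReal.ofReal_mul (Real.sqrt_nonneg _), ← Real.sqrt_mul hC.le]
    exact ENNReal.ofReal_le_ofReal (Real.le_sqrt_of_sq_le hbound)
end
end
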